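/- arXiv:2603.23045 — 10 statements merged into one kernel-verified Lean document; each statement's English description precedes it below -/
import Mathlib

section
/- Let p > 1 and let f : ℝ → ℝ be continuous, with F(s) = ∫₀ˢ f(t) dt. Suppose that liminf_{s→0⁺} F(s)/s^p > −∞ and that limsup_{s→0⁺} F(s)/s^p = L⁺ for some L⁺ ∈ (0, ∞]. Then there exist a constant M ≥ 0 and a sequence {γₙ} of positive reals with γₙ → 0 such that F(γₙ)/γₙ^p → L⁺ and −min_{t∈[0,γₙ]} F(t) ≤ M·F(γₙ) for every n. -/
open Filter Topology MeasureTheory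

theorem stmt0 (p : ℝ) (hp : 1 < p) (f : ℝ → ℝ) (hf : Continuous f)
    (F : ℝ → ℝ) (hF : ∀ s, F s = ∫ t in (0:ℝ)..s, f t)
    (hliminf : ⊥ < Filter.liminf (fun s : ℝ => ((F s / s ^ p : ℝ) : EReal)) (𝓝[>] (0:ℝ)))
    (L : EReal) (hL : 0 < L)
    (hlimsup : Filter.limsup (fun s : ℝ => ((F s / s ^ p : ℝ) : EReal)) (𝓝[>] (0:ℝ)) = L) :
    ∃ (M : ℝ) (γ : ℕ → ℝ), 0 ≤ M ∧ (∀ n, 0 < γ n) ∧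
      Tendsto γ atTop (𝓝 0) ∧
      Tendsto (fun n => ((F (γ n) / (γ n) ^ p : ℝ) : EReal)) atTop (𝓝 L) ∧
      ∀ n, -sInf (F '' Set.Icc 0 (γ n)) ≤ M * F (γ n) := by
  set u : ℝ → EReal := fun s : ℝ => ((F s / s ^ p : ℝ) : EReal) with hu
  have hF0 : F 0 = 0 := by simp [hF]
  obtain ⟨b, -, hb⟩ := EReal.lt_iff_exists_real_btwn.1 hliminf
  obtain ⟨l, hl0, hl⟩ := EReal.lt_iff_exists_real_btwn.1 hL
  have hl0 : 0 < l := by exact_mod_cast hl0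
  have hev := eventually_lt_of_lt_liminf hb
  obtain ⟨δ, hδ, hδ'⟩ := mem_nhdsGT_iff_exists_Ioo_subset.1 hev
  have hδ : 0 < δ := hδ
  obtain ⟨x, hx2, hx1⟩ := exists_seq_tendsto_limsup (f := 𝓝[>] (0:ℝ)) (u := u)
  rw [hlimsup] at hx2
  have hx2 : Tendsto (fun n => u (x n)) atTop (𝓝 L) := hx2
  have e1 : ∀ᶠ n in atTop, x n ∈ Set.Ioo 0 δ := hx1 (Ioo_mem_nhdsGT hδ)
  have e2 : ∀ᶠ n in atTop, (l : EReal) < u (x n) := hx2.eventually (lt_mem_nhds hl)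
  obtain ⟨N, hN⟩ := eventually_atTop.1 (e1.and e2)
  have hN' : ∀ n, x (n + N) ∈ Set.Ioo 0 δ ∧ (l : EReal) < u (x (n + N)) := fun n =>
    hN _ (Nat.le_add_left _ _)
  refine ⟨|b| / l, fun n => x (n + N), by positivity, fun n => (hN' n).1.1, ?_, ?_, ?_⟩
  · exact (tendsto_add_atTop_iff_nat N).2 (tendsto_nhds_of_tendsto_nhdsWithin hx1)
  · exact (tendsto_add_atTop_iff_nat N).2 hx2
  · intro n
    obtain ⟨⟨g0, gδ⟩, gl⟩ := hN' n
    show -sInf (F '' Set.Icc 0 (x (n + N))) ≤ |b| / l * F (x (n + N))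
    generalize x (n + N) = g at *
    have gl : l < F g / g ^ p := EReal.coe_lt_coe_iff.1 gl
    have gp : 0 < g ^ p := Real.rpow_pos_of_pos g0 p
    rw [lt_div_iff₀ gp] at gl
    have hkey : |b| * g ^ p ≤ |b| / l * F g := by
      rw [div_mul_eq_mul_div, le_div_iff₀ hl0, mul_assoc]
      exact mul_le_mul_of_nonneg_left (by linarith) (abs_nonneg b)
    refine le_trans ?_ hkey
    rw [neg_le]
    refine le_csInf ⟨F 0, 0, ⟨le_rfl, g0.le⟩, rfl⟩ ?_
    rintro _ ⟨t, ⟨t0, tg⟩, rfl⟩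
    rcases t0.eq_or_lt with h | h
    · rw [← h, hF0]
      have : 0 ≤ |b| * g ^ p := by positivity
      linarith
    · have h3 : (b : EReal) < u t := hδ' ⟨h, tg.trans_lt gδ⟩
      have h3 : b < F t / t ^ p := EReal.coe_lt_coe_iff.1 h3
      have tp : 0 < t ^ p := Real.rpow_pos_of_pos h p
      rw [lt_div_iff₀ tp] at h3
      have h4 : t ^ p ≤ g ^ p := Real.rpow_le_rpow t0 tg (by linarith)
      have h5 := mul_le_mul_of_nonneg_left h4 (abs_nonneg b)
      have h6 := mul_le_mul_of_nonneg_right (neg_abs_le b) tp.le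
      linarith
end

section
/- Let p > 1 and let f : ℝ → ℝ be continuous, with F(s) = ∫₀ˢ f(t) dt. Suppose that liminf_{s→∞} F(s)/s^p > −∞ and that limsup_{s→∞} F(s)/s^p = L⁺ for some L⁺ ∈ (0, ∞]. Then there exist a constant M ≥ 0 and a sequence {γₙ} of positive reals with γₙ → ∞ such that F(γₙ)/γₙ^p → L⁺ and −min_{t∈[0,γₙ]} F(t) ≤ M·F(γₙ) for every n. -/
open Filter Topology MeasureTheory

theorem stmt1 (p : ℝ) (hp : 1 < p) (f : ℝ → ℝ) (hf : Continuous f)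
    (F : ℝ → ℝ) (hF : ∀ s, F s = ∫ t in (0:ℝ)..s, f t)
    (hliminf : ⊥ < Filter.liminf (fun s : ℝ => ((F s / s ^ p : ℝ) : EReal)) atTop)
    (L : EReal) (hL : 0 < L)
    (hlimsup : Filter.limsup (fun s : ℝ => ((F s / s ^ p : ℝ) : EReal)) atTop = L) :
    ∃ (M : ℝ) (γ : ℕ → ℝ), 0 ≤ M ∧ (∀ n, 0 < γ n) ∧
      Tendsto γ atTop atTop ∧
      Tendsto (fun n => ((F (γ n) / (γ n) ^ p : ℝ) : EReal)) atTop (𝓝 L) ∧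
      ∀ n, -sInf (F '' Set.Icc 0 (γ n)) ≤ M * F (γ n) := by
  have hFc : Continuous F := by
    have : F = fun s => ∫ t in (0:ℝ)..s, f t := funext hF
    rw [this]
    exact intervalIntegral.continuous_primitive (fun a b => hf.intervalIntegrable a b) 0
  set u : ℝ → EReal := fun s : ℝ => ((F s / s ^ p : ℝ) : EReal) with hu
  -- cluster point
  have hne : (atTop ⊓ comap u (𝓝 L)).NeBot := by
    rw [Filter.inf_neBot_iff]
    intro s hs t ht
    obtain ⟨U, hU, hUt⟩ := ht
    obtain ⟨a, ha, haU⟩ := exists_Ioc_subset_of_mem_nhds hU ⟨0, hL⟩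
    have hfr : ∃ᶠ x in atTop, a < u x :=
      frequently_lt_of_lt_limsup (by isBoundedDefault) (by rw [hlimsup]; exact ha)
    have hev : ∀ᶠ x in atTop, u x ≤ L ∨ u x ∈ U := by
      by_cases hT : L = ⊤
      · exact Eventually.of_forall fun x => Or.inl (hT ▸ le_top)
      · obtain ⟨b, hb, hbU⟩ := exists_Ico_subset_of_mem_nhds hU ⟨⊤, lt_top_iff_ne_top.2 hT⟩
        have : ∀ᶠ x in atTop, u x < b :=
          eventually_lt_of_limsup_lt (by rw [hlimsup]; exact hb) (by isBoundedDefault)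
        filter_upwards [this] with x hx
        rcases le_total (u x) L with h | h
        · exact Or.inl h
        · exact Or.inr (hbU ⟨h, hx⟩)
    obtain ⟨x, hx1, hx2, hx3⟩ := (hfr.and_eventually (hev.and hs)).exists
    refine ⟨x, hx3, hUt ?_⟩
    rcases hx2 with h | h
    · exact haU ⟨hx1, h⟩
    · exact h
  obtain ⟨x, hx⟩ := Filter.exists_seq_tendsto (atTop ⊓ comap u (𝓝 L))
  rw [tendsto_inf, tendsto_comap_iff] at hx
  obtain ⟨hx1, hx2⟩ := hx
  -- constants
  obtain ⟨c, hc0, hcL⟩ := EReal.lt_iff_exists_real_btwn.1 hL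
  obtain ⟨d, _, hd⟩ := EReal.lt_iff_exists_real_btwn.1 hliminf
  have hdev : ∀ᶠ s in atTop, (d : EReal) < u s :=
    eventually_lt_of_lt_liminf hd (by isBoundedDefault)
  have hc : 0 < c := by exact_mod_cast hc0
  obtain ⟨S, hS⟩ := eventually_atTop.1 hdev
  obtain ⟨B, hB⟩ := (isCompact_Icc (a := (0:ℝ)) (b := max S 1)).exists_bound_of_continuousOn
    hFc.continuousOn
  have hB0 : 0 ≤ B := (norm_nonneg _).trans (hB 0 ⟨le_rfl, by positivity⟩)
  have hlow : ∀ s, 1 ≤ s → ∀ t ∈ Set.Icc 0 s, -((B + |d|) * s ^ p) ≤ F t := by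
    intro s hs t ht
    have h1 : 1 ≤ s ^ p := Real.one_le_rpow hs (by linarith)
    rcases le_total t (max S 1) with h | h
    · have h2 := (abs_le.1 (hB t ⟨ht.1, h⟩)).1
      nlinarith [abs_nonneg d, mul_nonneg hB0 (sub_nonneg.2 h1)]
    · have ht1 : 1 ≤ t := (le_max_right _ _).trans h
      have h2 : d < F t / t ^ p := EReal.coe_lt_coe_iff.1 (hS t ((le_max_left _ _).trans h))
      have h3 : 0 < t ^ p := Real.rpow_pos_of_pos (by linarith) _
      rw [lt_div_iff₀ h3] at h2
      have h4 : t ^ p ≤ s ^ p := Real.rpow_le_rpow ht.1 ht.2 (by linarith)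
      have h5 : |d| * t ^ p ≤ |d| * s ^ p := mul_le_mul_of_nonneg_left h4 (abs_nonneg d)
      have h6 : -|d| * t ^ p ≤ d * t ^ p := mul_le_mul_of_nonneg_right (neg_abs_le d) h3.le
      have h7 : 0 ≤ B * s ^ p := by positivity
      linarith
  have hev : ∀ᶠ n in atTop, 1 ≤ x n ∧ (c : EReal) < u (x n) :=
    (hx1.eventually_ge_atTop 1).and (hx2.eventually (lt_mem_nhds hcL))
  obtain ⟨N, hN⟩ := eventually_atTop.1 hev
  refine ⟨(B + |d|) / c, fun n => x (n + N), by positivity,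
    fun n => by linarith [(hN (n + N) (by omega)).1],
    hx1.comp (tendsto_add_atTop_nat N), hx2.comp (tendsto_add_atTop_nat N), fun n => ?_⟩
  obtain ⟨h1, h2⟩ := hN (n + N) (by omega)
  have h2' : c < F (x (n + N)) / x (n + N) ^ p := EReal.coe_lt_coe_iff.1 h2
  rw [lt_div_iff₀ (Real.rpow_pos_of_pos (by linarith) _)] at h2'
  have h3 : -((B + |d|) * x (n + N) ^ p) ≤ sInf (F '' Set.Icc 0 (x (n + N))) := by
    apply le_csInf
    · exact ⟨F 0, 0, ⟨le_rfl, by linarith⟩, rfl⟩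
    · rintro _ ⟨t, ht, rfl⟩
      exact hlow _ h1 t ht
  have h4 : (B + |d|) * x (n + N) ^ p ≤ (B + |d|) / c * F (x (n + N)) := by
    calc (B + |d|) * x (n + N) ^ p = (B + |d|) / c * (c * x (n + N) ^ p) := by field_simp
      _ ≤ _ := mul_le_mul_of_nonneg_left h2'.le (by positivity)
  linarith
end

section
/- Let p > 1 and let f : ℝ → ℝ be continuous, with F(s) = ∫₀ˢ f(t) dt and F̄(s) = F(s) − min_{t∈[0,s]} F(t). Suppose that L⁻ = liminf_{s→∞} F(s)/s^p > −∞ and L⁺ = limsup_{s→∞} F(s)/s^p < ∞. Then limsup_{s→∞} F̄(s)/s^p ≤ L⁺ − min{0, L⁻}. -/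
open Filter Topology MeasureTheory

theorem stmt4 (p : ℝ) (hp : 1 < p) (f : ℝ → ℝ) (hf : Continuous f)
    (F Fbar : ℝ → ℝ) (hF : ∀ s, F s = ∫ t in (0:ℝ)..s, f t)
    (hFbar : ∀ s, Fbar s = F s - sInf (F '' Set.Icc 0 s))
    (Lm Lp : ℝ)
    (hliminf : Filter.liminf (fun s : ℝ => ((F s / s ^ p : ℝ) : EReal)) atTop = (Lm : EReal))
    (hlimsup : Filter.limsup (fun s : ℝ => ((F s / s ^ p : ℝ) : EReal)) atTop = (Lp : EReal)) :
    Filter.limsup (fun s : ℝ => ((Fbar s / s ^ p : ℝ) : EReal)) atTop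
      ≤ ((Lp - min 0 Lm : ℝ) : EReal) := by
  rw [← EReal.le_of_forall_lt_iff_le]
  intro z hz
  have hz' : Lp - min 0 Lm < z := by exact_mod_cast hz
  obtain ⟨e, he, hze⟩ : ∃ e : ℝ, 0 < e ∧ z = Lp - min 0 Lm + 2 * e :=
    ⟨(z - (Lp - min 0 Lm)) / 2, by linarith, by ring⟩
  set m := min 0 Lm with hm
  have hm0 : m ≤ 0 := min_le_left _ _
  have hmL : m ≤ Lm := min_le_right _ _
  have h1 : ∀ᶠ s : ℝ in atTop, ((m - e : ℝ) : EReal) < ((F s / s ^ p : ℝ) : EReal) := by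
    refine eventually_lt_of_lt_liminf ?_
    rw [hliminf]
    exact_mod_cast (by linarith : m - e < Lm)
  have h2 : ∀ᶠ s : ℝ in atTop, ((F s / s ^ p : ℝ) : EReal) < ((Lp + e : ℝ) : EReal) := by
    refine eventually_lt_of_limsup_lt ?_
    rw [hlimsup]
    exact_mod_cast (by linarith : Lp < Lp + e)
  obtain ⟨S, hS⟩ := eventually_atTop.1 (h1.and (h2.and (eventually_gt_atTop (0:ℝ))))
  have hS0 : 0 < S := (hS S le_rfl).2.2
  have hFc : Continuous F := by
    have : F = fun s => ∫ t in (0:ℝ)..s, f t := funext hF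
    rw [this]
    exact intervalIntegral.continuous_primitive (fun a b => hf.intervalIntegrable a b) 0
  obtain ⟨B, hB⟩ := (isCompact_Icc (a := (0:ℝ)) (b := S)).bddBelow_image hFc.continuousOn
  have h3 : ∀ᶠ s : ℝ in atTop, -B / e ≤ s ^ p :=
    (tendsto_rpow_atTop (by linarith : 0 < p)).eventually_ge_atTop _
  have key : ∀ᶠ s : ℝ in atTop, ((Fbar s / s ^ p : ℝ) : EReal) ≤ (z : EReal) := by
    filter_upwards [h3, eventually_ge_atTop S] with s hs hsS
    obtain ⟨-, hb, hs0⟩ := hS s hsS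
    have hb' : F s / s ^ p < Lp + e := by exact_mod_cast hb
    have hsp : 0 < s ^ p := Real.rpow_pos_of_pos hs0 p
    rw [div_lt_iff₀ hsp] at hb'
    rw [div_le_iff₀ he] at hs
    have hinf : (m - e) * s ^ p ≤ sInf (F '' Set.Icc 0 s) := by
      apply le_csInf ((Set.nonempty_Icc.2 hs0.le).image F)
      rintro _ ⟨t, ⟨ht0, hts⟩, rfl⟩
      rcases le_total t S with h | h
      · have := hB ⟨t, ⟨ht0, h⟩, rfl⟩
        nlinarith [mul_nonneg (neg_nonneg.2 hm0) hsp.le]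
      · obtain ⟨ha, -, ht⟩ := hS t h
        have ha' : m - e < F t / t ^ p := by exact_mod_cast ha
        rw [lt_div_iff₀ (Real.rpow_pos_of_pos ht p)] at ha'
        have hmono : t ^ p ≤ s ^ p := Real.rpow_le_rpow ht0 hts (by linarith)
        nlinarith
    have : Fbar s / s ^ p ≤ z := by
      rw [div_le_iff₀ hsp, hFbar, hze]
      linarith
    exact_mod_cast this
  exact limsup_le_of_le (by isBoundedDefault) key
end

section
/- Let p > 1 and let f : ℝ → ℝ be continuous, with F(s) = ∫₀ˢ f(t) dt and F̄(s) = F(s) − min_{t∈[0,s]} F(t). Suppose that L⁻ = liminf_{s→0⁺} F(s)/s^p > −∞ and L⁺ = limsup_{s→0⁺} F(s)/s^p < ∞. Then limsup_{s→0⁺} F̄(s)/s^p ≤ L⁺ − min{0, L⁻}. -/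
open Filter Topology MeasureTheory

theorem stmt5 (p : ℝ) (hp : 1 < p) (f : ℝ → ℝ) (hf : Continuous f)
    (F Fbar : ℝ → ℝ) (hF : ∀ s, F s = ∫ t in (0:ℝ)..s, f t)
    (hFbar : ∀ s, Fbar s = F s - sInf (F '' Set.Icc 0 s))
    (Lm Lp : ℝ)
    (hliminf : Filter.liminf (fun s : ℝ => ((F s / s ^ p : ℝ) : EReal)) (𝓝[>] (0:ℝ)) = (Lm : EReal))
    (hlimsup : Filter.limsup (fun s : ℝ => ((F s / s ^ p : ℝ) : EReal)) (𝓝[>] (0:ℝ)) = (Lp : EReal)) :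
    Filter.limsup (fun s : ℝ => ((Fbar s / s ^ p : ℝ) : EReal)) (𝓝[>] (0:ℝ))
      ≤ ((Lp - min 0 Lm : ℝ) : EReal) := by
  refine EReal.le_of_forall_lt_iff_le.1 fun z hz => ?_
  have hz' : Lp - min 0 Lm < z := by exact_mod_cast hz
  obtain ⟨e, he, hez⟩ : ∃ e : ℝ, 0 < e ∧ Lp - min 0 Lm + 2 * e = z :=
    ⟨(z - (Lp - min 0 Lm)) / 2, by linarith, by ring⟩
  have h1 : ∀ᶠ s in 𝓝[>] (0:ℝ), ((F s / s ^ p : ℝ) : EReal) < ((Lp + e : ℝ) : EReal) := by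
    refine Filter.eventually_lt_of_limsup_lt ?_
    rw [hlimsup]
    exact_mod_cast (by linarith : Lp < Lp + e)
  have h2 : ∀ᶠ s in 𝓝[>] (0:ℝ), ((Lm - e : ℝ) : EReal) < ((F s / s ^ p : ℝ) : EReal) := by
    refine Filter.eventually_lt_of_lt_liminf ?_
    rw [hliminf]
    exact_mod_cast (by linarith : Lm - e < Lm)
  obtain ⟨d, hd, h2d⟩ := mem_nhdsGT_iff_exists_Ioo_subset.1 h2
  have hd0 : (0:ℝ) < d := hd
  have h3 : Set.Ioo 0 d ∈ 𝓝[>] (0:ℝ) := Ioo_mem_nhdsGT hd0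
  apply Filter.limsup_le_of_le
  · isBoundedDefault
  filter_upwards [h1, h3] with s hs1 hs3
  have hs0 : 0 < s := hs3.1
  have hsp : 0 < s ^ p := Real.rpow_pos_of_pos hs0 p
  have hs1' : F s / s ^ p < Lp + e := by exact_mod_cast hs1
  rw [div_lt_iff₀ hsp] at hs1'
  have hneg : min 0 Lm - e ≤ 0 := by linarith [min_le_left 0 Lm]
  have key : (min 0 Lm - e) * s ^ p ≤ sInf (F '' Set.Icc 0 s) := by
    apply le_csInf
    · exact ⟨F 0, 0, ⟨le_rfl, hs0.le⟩, rfl⟩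
    · rintro _ ⟨t, ⟨ht0, hts⟩, rfl⟩
      rcases ht0.eq_or_lt with h | h
      · subst h
        rw [hF 0, intervalIntegral.integral_same]
        exact mul_nonpos_of_nonpos_of_nonneg hneg hsp.le
      · have hmem : ((Lm - e : ℝ) : EReal) < ((F t / t ^ p : ℝ) : EReal) :=
          h2d ⟨h, hts.trans_lt hs3.2⟩
        have hm : Lm - e < F t / t ^ p := by exact_mod_cast hmem
        have htp : 0 < t ^ p := Real.rpow_pos_of_pos h p
        rw [lt_div_iff₀ htp] at hm
        have hle : t ^ p ≤ s ^ p := Real.rpow_le_rpow h.le hts (by linarith)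
        have a1 := mul_le_mul_of_nonpos_left hle hneg
        have a2 : (min 0 Lm - e) * t ^ p ≤ (Lm - e) * t ^ p :=
          mul_le_mul_of_nonneg_right (by linarith [min_le_right 0 Lm]) htp.le
        linarith
  have fin : Fbar s / s ^ p ≤ z := by
    rw [div_le_iff₀ hsp, hFbar, ← hez]
    nlinarith
  exact_mod_cast fin
end

section
/- Let p > 1, let N ≥ 1 be an integer, let R > 0, λ ∈ ℝ, and let f : ℝ → ℝ be continuous. Let v : [0,R] → ℝ be continuously differentiable with v'(0) = 0, and set φ(r) = |v'(r)|^{p−2} v'(r) (with φ(r) = 0 when v'(r) = 0). Assume that φ is differentiable on (0,R), that −φ'(r) − ((N−1)/r) φ(r) = λ f(v(r)) for every r ∈ (0,R), and that the function t ↦ |v'(t)|^p / t is integrable on (0,r) for every r ∈ (0,R]. Then for every r ∈ (0,R]: ((p−1)/p)|v'(r)|^p + (N−1) ∫₀ʳ |v'(t)|^p / t dt = λ ∫_{v(r)}^{v(0)} f(t) dt. -/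
open Filter Topology MeasureTheory

theorem stmt6 (p : ℝ) (hp : 1 < p) (N : ℕ) (hN : 1 ≤ N) (R lam : ℝ) (hR : 0 < R)
    (f : ℝ → ℝ) (hf : Continuous f)
    (v v' φ φ' : ℝ → ℝ)
    (hv : ∀ r ∈ Set.Icc (0:ℝ) R, HasDerivAt v (v' r) r)
    (hv'cont : ContinuousOn v' (Set.Icc 0 R))
    (hv'0 : v' 0 = 0)
    (hφ : ∀ r, φ r = |v' r| ^ (p - 2) * v' r)
    (hφ' : ∀ r ∈ Set.Ioo (0:ℝ) R, HasDerivAt φ (φ' r) r)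
    (hode : ∀ r ∈ Set.Ioo (0:ℝ) R, -φ' r - (((N:ℝ) - 1) / r) * φ r = lam * f (v r))
    (hint : ∀ r ∈ Set.Ioc (0:ℝ) R,
      IntervalIntegrable (fun t => |v' t| ^ p / t) volume 0 r) :
    ∀ r ∈ Set.Ioc (0:ℝ) R,
      ((p - 1) / p) * |v' r| ^ p + ((N:ℝ) - 1) * ∫ t in (0:ℝ)..r, |v' t| ^ p / t
        = lam * ∫ t in (v r)..(v 0), f t := by
  intro r hr
  have hp0 : p ≠ 0 := by linarith
  have hp1 : p - 1 ≠ 0 := by linarith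
  set q : ℝ := p / (p - 1) with hq
  have hq1 : 1 < q := by
    rw [hq, lt_div_iff₀ (by linarith)]; linarith
  have habs : ∀ t, |φ t| = |v' t| ^ (p - 1) := by
    intro t
    rw [hφ t]
    by_cases h : v' t = 0
    · simp [h, Real.zero_rpow hp1]
    · have h' : 0 < |v' t| := abs_pos.mpr h
      rw [abs_mul, abs_of_nonneg (Real.rpow_nonneg h'.le _)]
      have := Real.rpow_add_one h'.ne' (p - 2)
      rw [← this]; congr 1; ring
  have hpow : ∀ t, |φ t| ^ q = |v' t| ^ p := by
    intro t
    rw [habs, ← Real.rpow_mul (abs_nonneg _), hq]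
    congr 1; field_simp
  have hinv : ∀ t, |φ t| ^ (q - 2) * φ t = v' t := by
    intro t
    rw [habs, hφ t]
    by_cases h : v' t = 0
    · simp [h]
    · have h' : 0 < |v' t| := abs_pos.mpr h
      rw [← mul_assoc, ← Real.rpow_mul h'.le, ← Real.rpow_add h']
      have : (p - 1) * (q - 2) + (p - 2) = 0 := by
        rw [hq]; field_simp; ring
      rw [this]; simp
  have hprod : ∀ t, v' t * φ t = |v' t| ^ p := by
    intro t
    rw [hφ t]
    by_cases h : v' t = 0
    · simp [h, Real.zero_rpow hp0]
    · have h' : 0 < |v' t| := abs_pos.mpr h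
      have h2 := Real.rpow_add_natCast h'.ne' (p - 2) 2
      have : v' t * (|v' t| ^ (p - 2) * v' t) = |v' t| ^ (p - 2) * |v' t| ^ 2 := by
        rw [sq_abs]; ring
      rw [this, ← h2]; congr 1; push_cast; ring
  have hG : ∀ x, HasDerivAt (fun x => ∫ t in x..(v 0), f t) (-f x) x := fun x =>
    intervalIntegral.integral_hasDerivAt_left (hf.intervalIntegrable _ _)
      (hf.stronglyMeasurableAtFilter _ _) hf.continuousAt
  have hvc : ContinuousOn v (Set.Icc 0 r) := fun t ht =>
    (hv t ⟨ht.1, ht.2.trans hr.2⟩).continuousAt.continuousWithinAt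
  have key := intervalIntegral.integral_eq_sub_of_hasDerivAt_of_le
    (f := fun t => ((p - 1) / p) * |v' t| ^ p - lam * ∫ s in (v t)..(v 0), f s)
    (f' := fun t => -((N:ℝ) - 1) * (|v' t| ^ p / t)) hr.1.le ?_ ?_ ?_
  · rw [intervalIntegral.integral_const_mul] at key
    simp only [hv'0, abs_zero, Real.zero_rpow hp0, intervalIntegral.integral_same] at key
    linarith
  · apply ContinuousOn.sub
    · apply ContinuousOn.mul continuousOn_const
      apply ContinuousOn.rpow_const
      · exact (hv'cont.mono (Set.Icc_subset_Icc_right hr.2)).abs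
      · intro x _; right; linarith
    · apply ContinuousOn.mul continuousOn_const
      have hc : Continuous (fun x => ∫ t in x..(v 0), f t) :=
        continuous_iff_continuousAt.mpr fun x => (hG x).continuousAt
      exact hc.comp_continuousOn hvc
  · intro t ht
    have htR : t ∈ Set.Ioo 0 R := ⟨ht.1, ht.2.trans_le hr.2⟩
    have h1 := ((hasDerivAt_abs_rpow (φ t) hq1).comp t (hφ' t htR)).const_mul ((p-1)/p)
    have h2 := ((hG (v t)).comp t (hv t ⟨htR.1.le, htR.2.le⟩)).const_mul lam
    have h3 := h1.sub h2
    have e := hode t htR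
    have ht0 : t ≠ 0 := ht.1.ne'
    convert h3 using 1
    · funext s; simp [hpow]
    · have hqq : (p-1)/p * q = 1 := by rw [hq]; field_simp
      have e1 : φ' t = - ((((N:ℝ) - 1) / t) * φ t) - lam * f (v t) := by linarith
      have e2 : (p-1)/p * (q * |φ t| ^ (q-2) * φ t * φ' t) = v' t * φ' t := by
        rw [← hinv t]; linear_combination (|φ t| ^ (q-2) * φ t * φ' t) * hqq
      rw [e2, e1, ← hprod]; ring
  · exact (hint r hr).const_mul _
end

section
/- Let p > 1, let N ≥ 1 be an integer, let R > 0, λ > 0, and let f : ℝ → ℝ be continuous with F(s) = ∫₀ˢ f(t) dt. Let v : [0,R] → ℝ be continuously differentiable with v'(0) = 0 and v(R) = 0, set φ(r) = |v'(r)|^{p−2} v'(r) (with φ(r) = 0 when v'(r) = 0), and assume that φ is differentiable on (0,R), that −φ'(r) − ((N−1)/r) φ(r) = λ f(v(r)) for every r ∈ (0,R), and that t ↦ |v'(t)|^p / t is integrable on (0,R). Then F(v(0)) ≥ 0. -/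
open Filter Topology MeasureTheory

theorem stmt7 (p : ℝ) (hp : 1 < p) (N : ℕ) (hN : 1 ≤ N) (R lam : ℝ) (hR : 0 < R)
    (hlam : 0 < lam)
    (f : ℝ → ℝ) (hf : Continuous f)
    (F : ℝ → ℝ) (hF : ∀ s, F s = ∫ t in (0:ℝ)..s, f t)
    (v v' φ φ' : ℝ → ℝ)
    (hv : ∀ r ∈ Set.Icc (0:ℝ) R, HasDerivAt v (v' r) r)
    (hv'cont : ContinuousOn v' (Set.Icc 0 R))
    (hv'0 : v' 0 = 0)
    (hvR : v R = 0)
    (hφ : ∀ r, φ r = |v' r| ^ (p - 2) * v' r)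
    (hφ' : ∀ r ∈ Set.Ioo (0:ℝ) R, HasDerivAt φ (φ' r) r)
    (hode : ∀ r ∈ Set.Ioo (0:ℝ) R, -φ' r - (((N:ℝ) - 1) / r) * φ r = lam * f (v r))
    (hint : IntervalIntegrable (fun t => |v' t| ^ p / t) volume 0 R) :
    F (v 0) ≥ 0 := by
  have hp1 : p - 1 ≠ 0 := by linarith
  have hp0 : 0 < p - 1 := by linarith
  have hq : 1 < p / (p - 1) := by rw [lt_div_iff₀ hp0]; linarith
  have hFd : ∀ s, HasDerivAt F (f s) s := by
    intro s
    have h : F = fun s => ∫ t in (0:ℝ)..s, f t := funext hF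
    rw [h]
    exact intervalIntegral.integral_hasDerivAt_right (hf.intervalIntegrable _ _)
      (hf.stronglyMeasurableAtFilter _ _) hf.continuousAt
  have hφabs : ∀ r, |φ r| = |v' r| ^ (p - 1) := by
    intro r
    rw [hφ r, abs_mul, abs_of_nonneg (Real.rpow_nonneg (abs_nonneg _) _)]
    rcases eq_or_ne (v' r) 0 with h | h
    · simp [h, Real.zero_rpow hp1]
    · have h0 : 0 < |v' r| := abs_pos.mpr h
      rw [← Real.rpow_add_one h0.ne']
      congr 1; ring
  have hpow : ∀ r, |φ r| ^ (p / (p - 1)) = |v' r| ^ p := by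
    intro r
    rw [hφabs, ← Real.rpow_mul (abs_nonneg _)]
    congr 1; field_simp
  have hinv : ∀ r, |φ r| ^ (p / (p - 1) - 2) * φ r = v' r := by
    intro r
    rw [hφabs, ← Real.rpow_mul (abs_nonneg _), hφ r]
    rcases eq_or_ne (v' r) 0 with h | h
    · simp [h]
    · have h0 : 0 < |v' r| := abs_pos.mpr h
      rw [← mul_assoc, ← Real.rpow_add h0]
      have : (p - 1) * (p / (p - 1) - 2) + (p - 2) = 0 := by field_simp; ring
      rw [this]; simp
  have hφv : ∀ r, 0 ≤ φ r * v' r := by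
    intro r
    rw [hφ r, mul_assoc]
    exact mul_nonneg (Real.rpow_nonneg (abs_nonneg _) _) (mul_self_nonneg _)
  have hd : ∀ r ∈ Set.Ioo (0:ℝ) R, HasDerivAt
      (fun r => (p - 1) / p * |v' r| ^ p + lam * F (v r))
      (-(((N:ℝ) - 1) / r * (φ r * v' r))) r := by
    intro r hr
    have h1 := ((hasDerivAt_abs_rpow (φ r) hq).comp r (hφ' r hr)).const_mul ((p - 1) / p)
    have h2 := ((hFd (v r)).comp r (hv r ⟨hr.1.le, hr.2.le⟩)).const_mul lam
    have h3 := h1.add h2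
    have e : (fun r => (p - 1) / p * |v' r| ^ p + lam * F (v r)) =
        (fun r => (p - 1) / p * |φ r| ^ (p / (p - 1)) + lam * F (v r)) := by
      funext x; rw [hpow]
    rw [e]
    refine HasDerivAt.congr_deriv h3 ?_
    rw [mul_assoc (p / (p - 1)), hinv r]
    have h4 : (p - 1) / p * (p / (p - 1) * v' r * φ' r) = v' r * φ' r := by
      field_simp
    rw [h4]
    linear_combination (-v' r) * hode r hr
  have hcont : ContinuousOn (fun r => (p - 1) / p * |v' r| ^ p + lam * F (v r))
      (Set.Icc 0 R) := by
    have c1 : ContinuousOn v (Set.Icc 0 R) := fun x hx => (hv x hx).continuousAt.continuousWithinAt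
    have c2 : Continuous F := continuous_iff_continuousAt.mpr fun s => (hFd s).continuousAt
    exact (continuousOn_const.mul (hv'cont.abs.rpow_const fun x _ => Or.inr (by linarith))).add
      (continuousOn_const.mul (c2.comp_continuousOn c1))
  have hanti := antitoneOn_of_deriv_nonpos (convex_Icc 0 R) hcont
    (by
      rw [interior_Icc]
      exact fun r hr => (hd r hr).differentiableAt.differentiableWithinAt)
    (by
      rw [interior_Icc]
      intro r hr
      rw [(hd r hr).deriv, neg_nonpos]
      have : (1:ℝ) ≤ N := by exact_mod_cast hN
      exact mul_nonneg (div_nonneg (by linarith) hr.1.le) (hφv r))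
  have h := hanti (Set.left_mem_Icc.mpr hR.le) (Set.right_mem_Icc.mpr hR.le) hR.le
  have hF0 : F 0 = 0 := by simp [hF]
  have hpp : p ≠ 0 := by linarith
  simp only [hv'0, hvR, hF0, abs_zero, Real.zero_rpow hpp, mul_zero, add_zero, zero_add] at h
  have h5 : 0 ≤ (p - 1) / p * |v' R| ^ p :=
    mul_nonneg (div_nonneg hp0.le (by linarith)) (Real.rpow_nonneg (abs_nonneg _) _)
  exact nonneg_of_mul_nonneg_right (h5.trans h) hlam
end

section
/- Let p > 1, let N ≥ 1 be an integer, let R > 0, λ ≥ 0, and let f : ℝ → ℝ be continuous with F(s) = ∫₀ˢ f(t) dt and F̄(s) = F(s) − min_{t∈[0,s]} F(t). Let v : [0,R] → ℝ be continuously differentiable with v'(0) = 0, v(R) = 0, v(0) > 0, and 0 ≤ v(r) ≤ v(0) for all r ∈ [0,R]. Set φ(r) = |v'(r)|^{p−2} v'(r) (with φ(r) = 0 when v'(r) = 0), and assume that φ is differentiable on (0,R), that −φ'(r) − ((N−1)/r) φ(r) = λ f(v(r)) for every r ∈ (0,R), and that t ↦ |v'(t)|^p / t is integrable on (0,R). Then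 ((p−1)/(p R^p)) · v(0)^p ≤ λ · F̄(v(0)). -/
open Filter Topology MeasureTheory

theorem stmt8 (p : ℝ) (hp : 1 < p) (N : ℕ) (hN : 1 ≤ N) (R lam : ℝ) (hR : 0 < R)
    (hlam : 0 ≤ lam)
    (f : ℝ → ℝ) (hf : Continuous f)
    (F Fbar : ℝ → ℝ) (hF : ∀ s, F s = ∫ t in (0:ℝ)..s, f t)
    (hFbar : ∀ s, Fbar s = F s - sInf (F '' Set.Icc 0 s))
    (v v' φ φ' : ℝ → ℝ)
    (hv : ∀ r ∈ Set.Icc (0:ℝ) R, HasDerivAt v (v' r) r)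
    (hv'cont : ContinuousOn v' (Set.Icc 0 R))
    (hv'0 : v' 0 = 0)
    (hvR : v R = 0)
    (hv0 : 0 < v 0)
    (hvbd : ∀ r ∈ Set.Icc (0:ℝ) R, 0 ≤ v r ∧ v r ≤ v 0)
    (hφ : ∀ r, φ r = |v' r| ^ (p - 2) * v' r)
    (hφ' : ∀ r ∈ Set.Ioo (0:ℝ) R, HasDerivAt φ (φ' r) r)
    (hode : ∀ r ∈ Set.Ioo (0:ℝ) R, -φ' r - (((N:ℝ) - 1) / r) * φ r = lam * f (v r))
    (hint : IntervalIntegrable (fun t => |v' t| ^ p / t) volume 0 R) :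
    ((p - 1) / (p * R ^ p)) * (v 0) ^ p ≤ lam * Fbar (v 0) := by
  have hFd : ∀ s, HasDerivAt F (f s) s := by
    intro s
    have : F = fun s => ∫ t in (0:ℝ)..s, f t := funext hF
    rw [this]
    exact intervalIntegral.integral_hasDerivAt_right (hf.intervalIntegrable _ _)
      hf.aestronglyMeasurable.stronglyMeasurableAtFilter hf.continuousAt
  have hFc : Continuous F := continuous_iff_continuousAt.2 fun s => (hFd s).continuousAt
  have hp1 : 0 < p - 1 := by linarith
  have hp0 : 0 < p := by linarith
  have hq : 1 < p / (p - 1) := by rw [lt_div_iff₀ hp1]; linarith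
  have habs : ∀ r, |φ r| = |v' r| ^ (p - 1) := by
    intro r
    rw [hφ]
    by_cases h : v' r = 0
    · simp [h, Real.zero_rpow hp1.ne']
    · have h' : 0 < |v' r| := abs_pos.2 h
      rw [abs_mul, abs_of_nonneg (Real.rpow_nonneg h'.le _)]
      nth_rewrite 2 [← Real.rpow_one |v' r|]
      rw [← Real.rpow_add h']
      congr 1; ring
  have hpow : ∀ r, |φ r| ^ (p / (p - 1)) = |v' r| ^ p := by
    intro r
    rw [habs, ← Real.rpow_mul (abs_nonneg _)]
    congr 1; field_simp
  have hinv : ∀ r, |φ r| ^ (p / (p - 1) - 2) * φ r = v' r := by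
    intro r
    by_cases h : v' r = 0
    · simp [hφ, h]
    · have h' : 0 < |v' r| := abs_pos.2 h
      rw [habs, ← Real.rpow_mul h'.le, hφ, ← mul_assoc, ← Real.rpow_add h']
      have : (p - 1) * (p / (p - 1) - 2) + (p - 2) = 0 := by field_simp; ring
      rw [this]; simp
  have hvphi : ∀ r, v' r * φ r = |v' r| ^ p := by
    intro r
    by_cases h : v' r = 0
    · simp [h, Real.zero_rpow hp0.ne']
    · have h' : 0 < |v' r| := abs_pos.2 h
      have e : v' r * (|v' r| ^ (p - 2) * v' r) = |v' r| ^ (p - 2) * |v' r| ^ (2:ℝ) := by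
        rw [Real.rpow_two, sq_abs]; ring
      rw [hφ, e, ← Real.rpow_add h']
      congr 1; ring
  have hEd : ∀ r ∈ Set.Ioo (0:ℝ) R,
      HasDerivAt (fun r => (p - 1) / p * |v' r| ^ p + lam * F (v r))
        (-(((N:ℝ) - 1) / r) * |v' r| ^ p) r := by
    intro r hr
    have h1 := (hasDerivAt_abs_rpow (φ r) hq).comp r (hφ' r hr)
    have h2 := (hFd (v r)).comp r (hv r (Set.Ioo_subset_Icc_self hr))
    have h3 := (h1.const_mul ((p - 1) / p)).add (h2.const_mul lam)
    have e1 : (fun r => (p - 1) / p * |v' r| ^ p + lam * F (v r)) =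
        (fun r => (p - 1) / p * |φ r| ^ (p / (p - 1)) + lam * F (v r)) := by
      funext r; rw [hpow]
    rw [e1]
    refine h3.congr_deriv ?_
    have e2 : (p - 1) / p * (p / (p - 1) * |φ r| ^ (p / (p - 1) - 2) * φ r * φ' r)
        = (|φ r| ^ (p / (p - 1) - 2) * φ r) * φ' r := by
      field_simp
    rw [e2, hinv, ← hvphi]
    have := hode r hr
    linear_combination (-v' r) * this
  have hvc : ContinuousOn v (Set.Icc 0 R) := fun r hr => (hv r hr).continuousAt.continuousWithinAt
  have hEc : ContinuousOn (fun r => (p - 1) / p * |v' r| ^ p + lam * F (v r)) (Set.Icc 0 R) := by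
    refine (continuousOn_const.mul (hv'cont.abs.rpow_const fun _ _ => Or.inr hp0.le)).add
      (continuousOn_const.mul (hFc.comp_continuousOn hvc))
  have hanti := antitoneOn_of_deriv_nonpos (convex_Icc (0:ℝ) R) hEc
    (by
      rw [interior_Icc]
      exact fun r hr => (hEd r hr).differentiableAt.differentiableWithinAt)
    (by
      rw [interior_Icc]
      intro r hr
      rw [(hEd r hr).deriv]
      have hN' : (0:ℝ) ≤ (N:ℝ) - 1 := by
        have : (1:ℝ) ≤ N := by exact_mod_cast hN
        linarith
      have := div_nonneg hN' hr.1.le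
      have h2 : 0 ≤ |v' r| ^ p := Real.rpow_nonneg (abs_nonneg _) _
      nlinarith [mul_nonneg this h2])
  obtain ⟨c, hc, hcv⟩ := exists_hasDerivAt_eq_slope v v' hR hvc
    (fun r hr => hv r (Set.Ioo_subset_Icc_self hr))
  have hcI := Set.Ioo_subset_Icc_self hc
  have hE := hanti (Set.left_mem_Icc.2 hR.le) hcI hc.1.le
  have hinf : sInf (F '' Set.Icc 0 (v 0)) ≤ F (v c) :=
    csInf_le (isCompact_Icc.image hFc).bddBelow ⟨v c, hvbd c hcI, rfl⟩
  have hcabs : |v' c| = v 0 / R := by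
    rw [hcv, hvR, sub_zero, zero_sub, neg_div, abs_neg, abs_of_pos (div_pos hv0 hR)]
  simp only [hv'0, abs_zero, Real.zero_rpow hp0.ne', hcabs, Real.div_rpow hv0.le hR.le] at hE
  have hfin := mul_le_mul_of_nonneg_left hinf hlam
  have e : ((p - 1) / (p * R ^ p)) * (v 0) ^ p = (p - 1) / p * ((v 0) ^ p / R ^ p) := by
    have := Real.rpow_pos_of_pos hR p
    field_simp
  rw [e, hFbar]
  linarith
end

section
/- Let N ≥ 1 be an integer, let R > 0, λ ≥ 0, Λ ≥ 1, and let f : ℝ → ℝ be continuous, with F_Λ(s) = ∫₀ˢ f⁺(t) dt − (1/Λ²) ∫₀ˢ f⁻(t) dt where f⁺ = max{f, 0} and f⁻ = max{−f, 0}. Let v : [0,R] → ℝ be twice continuously differentiable with v'(0) = 0 and v'(r) < 0 for all r ∈ (0,R). Assume that for every r ∈ (0,R): if v''(r) ≤ 0 then −(1/Λ) v''(r) − ((N−1)/(Λ r)) v'(r) = λ f(v(r)), and if v''(r) ≥ 0 then −Λ v''(r) − ((N−1)/(Λ r)) v'(r) = λ f(v(r)). Then for every r ∈ [0,R]: (1/(2Λ))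 (v'(r))² ≤ λ ( F_Λ(v(0)) − F_Λ(v(r)) ). -/
open Filter Topology MeasureTheory

theorem stmt9 (N : ℕ) (hN : 1 ≤ N) (R lam Λ : ℝ) (hR : 0 < R) (hlam : 0 ≤ lam) (hΛ : 1 ≤ Λ)
    (f : ℝ → ℝ) (hf : Continuous f)
    (FΛ : ℝ → ℝ)
    (hFΛ : ∀ s, FΛ s = (∫ t in (0:ℝ)..s, max (f t) 0)
      - (1 / Λ ^ 2) * ∫ t in (0:ℝ)..s, max (-f t) 0)
    (v v' v'' : ℝ → ℝ)
    (hv : ∀ r ∈ Set.Icc (0:ℝ) R, HasDerivAt v (v' r) r)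
    (hv' : ∀ r ∈ Set.Icc (0:ℝ) R, HasDerivAt v' (v'' r) r)
    (hv''cont : ContinuousOn v'' (Set.Icc 0 R))
    (hv'0 : v' 0 = 0)
    (hdec : ∀ r ∈ Set.Ioo (0:ℝ) R, v' r < 0)
    (hode1 : ∀ r ∈ Set.Ioo (0:ℝ) R, v'' r ≤ 0 →
      -(1 / Λ) * v'' r - (((N:ℝ) - 1) / (Λ * r)) * v' r = lam * f (v r))
    (hode2 : ∀ r ∈ Set.Ioo (0:ℝ) R, 0 ≤ v'' r →
      -Λ * v'' r - (((N:ℝ) - 1) / (Λ * r)) * v' r = lam * f (v r)) :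
    ∀ r ∈ Set.Icc (0:ℝ) R,
      (1 / (2 * Λ)) * (v' r) ^ 2 ≤ lam * (FΛ (v 0) - FΛ (v r)) := by
  have hΛ0 : 0 < Λ := by linarith
  have hc1 : Continuous fun t => max (f t) 0 := by fun_prop
  have hc2 : Continuous fun t => max (-f t) 0 := by fun_prop
  have hF : ∀ s, HasDerivAt FΛ (max (f s) 0 - (1 / Λ ^ 2) * max (-f s) 0) s := by
    intro s
    have e : FΛ = fun s => (∫ t in (0:ℝ)..s, max (f t) 0)
      - (1 / Λ ^ 2) * ∫ t in (0:ℝ)..s, max (-f t) 0 := funext hFΛ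
    rw [e]
    exact ((hc1.integral_hasStrictDerivAt 0 s).hasDerivAt).sub
      (((hc2.integral_hasStrictDerivAt 0 s).hasDerivAt).const_mul _)
  have hG : ∀ r ∈ Set.Icc (0:ℝ) R, HasDerivAt
      (fun r => (1 / (2 * Λ)) * (v' r) ^ 2 + lam * FΛ (v r))
      (v' r * (v'' r / Λ + lam * (max (f (v r)) 0 - (1 / Λ ^ 2) * max (-f (v r)) 0))) r := by
    intro r hr
    have h1 := (((hv' r hr).pow 2).const_mul (1 / (2 * Λ))).add
      (((hF (v r)).comp r (hv r hr)).const_mul lam)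
    refine h1.congr_deriv ?_
    field_simp
    norm_num
    ring
  have hanti : AntitoneOn (fun r => (1 / (2 * Λ)) * (v' r) ^ 2 + lam * FΛ (v r))
      (Set.Icc 0 R) := by
    apply antitoneOn_of_deriv_nonpos (convex_Icc 0 R)
    · exact fun r hr => (hG r hr).continuousAt.continuousWithinAt
    · rw [interior_Icc]
      exact fun r hr =>
        (hG r (Set.Ioo_subset_Icc_self hr)).differentiableAt.differentiableWithinAt
    · rw [interior_Icc]
      intro r hr
      rw [(hG r (Set.Ioo_subset_Icc_self hr)).deriv]
      have hd := hdec r hr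
      apply mul_nonpos_of_nonpos_of_nonneg hd.le
      have hN' : (0:ℝ) ≤ (N:ℝ) - 1 := by
        have : (1:ℝ) ≤ N := by exact_mod_cast hN
        linarith
      have hc : (((N:ℝ) - 1) / (Λ * r)) * v' r ≤ 0 :=
        mul_nonpos_of_nonneg_of_nonpos (div_nonneg hN' (mul_pos hΛ0 hr.1).le) hd.le
      have o1 := hode1 r hr
      have o2 := hode2 r hr
      generalize (((N:ℝ) - 1) / (Λ * r)) * v' r = c at hc o1 o2
      rcases le_total (f (v r)) 0 with h | h
      · rw [max_eq_right h, max_eq_left (by linarith)]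
        have key : v'' r / Λ + lam * (0 - 1 / Λ ^ 2 * -f (v r))
            = (Λ * v'' r + lam * f (v r)) / Λ ^ 2 := by
          field_simp
          ring
        rw [key]
        apply div_nonneg _ (by positivity)
        rcases le_total (v'' r) 0 with h' | h'
        · have h3 := o1 h'
          have h4 : lam * f (v r) ≤ 0 := mul_nonpos_of_nonneg_of_nonpos hlam h
          have h5 : 0 ≤ -(1 / Λ) * v'' r := by
            have := mul_nonneg (one_div_pos.2 hΛ0).le (neg_nonneg.2 h')
            linarith
          have h6 : (1 / Λ) * v'' r = 0 := by linarith
          have h7 : v'' r = 0 := by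
            rcases mul_eq_zero.1 h6 with h | h
            · exact absurd h (one_div_pos.2 hΛ0).ne'
            · exact h
          rw [h7] at h3 ⊢
          linarith
        · linarith [o2 h']
      · rw [max_eq_left h, max_eq_right (by linarith)]
        have h4 : 0 ≤ lam * f (v r) := mul_nonneg hlam h
        rcases le_total (v'' r) 0 with h' | h'
        · have h3 := o1 h'
          have : v'' r / Λ = 1 / Λ * v'' r := by ring
          rw [this]
          linarith
        · have := div_nonneg h' hΛ0.le
          linarith
  intro r hr
  have h := hanti (Set.left_mem_Icc.2 hR.le) hr hr.1
  simp only [hv'0] at h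
  linarith
end

section
/- Let N ≥ 1 be an integer, let R > 0, λ ≥ 0, Λ ≥ 1, and let f : ℝ → ℝ be continuous, with F_Λ(s) = ∫₀ˢ f⁺(t) dt − (1/Λ²) ∫₀ˢ f⁻(t) dt and F̄_Λ(s) = F_Λ(s) − min_{t∈[0,s]} F_Λ(t). Let v : [0,R] → ℝ be twice continuously differentiable with v'(0) = 0, v(R) = 0, v(0) > 0, and v'(r) < 0 for all r ∈ (0,R). Assume that for every r ∈ (0,R): if v''(r) ≤ 0 then −(1/Λ) v''(r) − ((N−1)/(Λ r)) v'(r) = λ f(v(r)), and if v''(r) ≥ 0 then −Λ v''(r) − ((N−1)/(Λ r)) v'(r) = λ f(v(r)). Then v(0)² / (2Λ R²) ≤ λ · F̄_Λ(v(0)). -/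
open Filter Topology MeasureTheory

theorem stmt10 (N : ℕ) (hN : 1 ≤ N) (R lam Λ : ℝ) (hR : 0 < R) (hlam : 0 ≤ lam) (hΛ : 1 ≤ Λ)
    (f : ℝ → ℝ) (hf : Continuous f)
    (FΛ FbarΛ : ℝ → ℝ)
    (hFΛ : ∀ s, FΛ s = (∫ t in (0:ℝ)..s, max (f t) 0)
      - (1 / Λ ^ 2) * ∫ t in (0:ℝ)..s, max (-f t) 0)
    (hFbarΛ : ∀ s, FbarΛ s = FΛ s - sInf (FΛ '' Set.Icc 0 s))
    (v v' v'' : ℝ → ℝ)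
    (hv : ∀ r ∈ Set.Icc (0:ℝ) R, HasDerivAt v (v' r) r)
    (hv' : ∀ r ∈ Set.Icc (0:ℝ) R, HasDerivAt v' (v'' r) r)
    (hv''cont : ContinuousOn v'' (Set.Icc 0 R))
    (hv'0 : v' 0 = 0)
    (hvR : v R = 0)
    (hv0 : 0 < v 0)
    (hdec : ∀ r ∈ Set.Ioo (0:ℝ) R, v' r < 0)
    (hode1 : ∀ r ∈ Set.Ioo (0:ℝ) R, v'' r ≤ 0 →
      -(1 / Λ) * v'' r - (((N:ℝ) - 1) / (Λ * r)) * v' r = lam * f (v r))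
    (hode2 : ∀ r ∈ Set.Ioo (0:ℝ) R, 0 ≤ v'' r →
      -Λ * v'' r - (((N:ℝ) - 1) / (Λ * r)) * v' r = lam * f (v r)) :
    (v 0) ^ 2 / (2 * Λ * R ^ 2) ≤ lam * FbarΛ (v 0) := by
  have hΛ0 : 0 < Λ := by linarith
  have hFd : ∀ s, HasDerivAt FΛ (max (f s) 0 - (1 / Λ ^ 2) * max (-f s) 0) s := by
    intro s
    have e : FΛ = fun s => (∫ t in (0:ℝ)..s, max (f t) 0)
      - (1 / Λ ^ 2) * ∫ t in (0:ℝ)..s, max (-f t) 0 := funext hFΛ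
    rw [e]
    have c1 : Continuous fun t => max (f t) 0 := by fun_prop
    have c2 : Continuous fun t => max (-f t) 0 := by fun_prop
    exact (c1.integral_hasStrictDerivAt 0 s).hasDerivAt.sub
      ((c2.integral_hasStrictDerivAt 0 s).hasDerivAt.const_mul _)
  have hFc : Continuous FΛ := continuous_iff_continuousAt.2 fun s => (hFd s).continuousAt
  have key : ∀ r ∈ Set.Ioo (0:ℝ) R,
      -(v'' r) / Λ ≤ lam * (max (f (v r)) 0 - (1 / Λ ^ 2) * max (-f (v r)) 0) := by
    intro r hr
    have hN' : (0:ℝ) ≤ (N:ℝ) - 1 := by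
      have : (1:ℝ) ≤ N := by exact_mod_cast hN
      linarith
    have hc : 0 ≤ -((((N:ℝ) - 1) / (Λ * r)) * v' r) := by
      have h1 : 0 ≤ ((N:ℝ) - 1) / (Λ * r) := div_nonneg hN' (mul_pos hΛ0 hr.1).le
      have h2 := hdec r hr
      nlinarith
    have hi0 : 0 < 1 / Λ ^ 2 := by positivity
    have hi1 : 1 / Λ ^ 2 ≤ 1 := by
      rw [div_le_one (by positivity)]; nlinarith
    rcases le_total (v'' r) 0 with h | h
    · have h1 := hode1 r hr h
      have e : -(v'' r) / Λ = -(1 / Λ) * v'' r := by ring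
      have h3 : 0 ≤ -(v'' r) / Λ := div_nonneg (by linarith) hΛ0.le
      rcases le_total 0 (f (v r)) with hf0 | hf0
      · rw [max_eq_left hf0, max_eq_right (by linarith : -f (v r) ≤ 0)]
        linarith
      · have h4 : lam * f (v r) ≤ 0 := mul_nonpos_of_nonneg_of_nonpos hlam hf0
        rw [max_eq_right hf0, max_eq_left (by linarith : 0 ≤ -f (v r))]
        have h5 : lam * f (v r) = 0 := by linarith
        have : lam * (0 - 1 / Λ ^ 2 * -f (v r)) = (1 / Λ ^ 2) * (lam * f (v r)) := by ring
        rw [this, h5]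
        linarith
    · have h1 := hode2 r hr h
      have e : -(v'' r) / Λ = (1 / Λ ^ 2) * (-Λ * v'' r) := by field_simp
      have h2 : -(v'' r) / Λ ≤ (1 / Λ ^ 2) * (lam * f (v r)) := by
        rw [e]
        exact mul_le_mul_of_nonneg_left (by linarith) hi0.le
      rcases le_total 0 (f (v r)) with hf0 | hf0
      · rw [max_eq_left hf0, max_eq_right (by linarith : -f (v r) ≤ 0)]
        have := mul_nonneg hlam hf0
        nlinarith
      · rw [max_eq_right hf0, max_eq_left (by linarith : 0 ≤ -f (v r))]
        linarith
  have hG : ∀ r ∈ Set.Icc (0:ℝ) R, HasDerivAt (fun r => v' r ^ 2 / (2 * Λ) + lam * FΛ (v r))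
      ((2 * v' r * v'' r) / (2 * Λ) +
        lam * ((max (f (v r)) 0 - (1 / Λ ^ 2) * max (-f (v r)) 0) * v' r)) r := by
    intro r hr
    have h1 := ((hv' r hr).pow 2).div_const (2 * Λ)
    have h2 := ((hFd (v r)).comp r (hv r hr)).const_mul lam
    exact (h1.add h2).congr_deriv (by simp)
  have hanti : AntitoneOn (fun r => v' r ^ 2 / (2 * Λ) + lam * FΛ (v r)) (Set.Icc 0 R) := by
    apply antitoneOn_of_deriv_nonpos (convex_Icc 0 R)
    · exact fun r hr => (hG r hr).continuousAt.continuousWithinAt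
    · rw [interior_Icc]
      exact fun r hr => (hG r (Set.Ioo_subset_Icc_self hr)).differentiableAt.differentiableWithinAt
    · rw [interior_Icc]
      intro r hr
      rw [(hG r (Set.Ioo_subset_Icc_self hr)).deriv]
      have h1 := key r hr
      have h2 := hdec r hr
      have e : (2 * v' r * v'' r) / (2 * Λ) = -(-(v'' r) / Λ * v' r) := by field_simp
      rw [e]
      nlinarith
  have hvanti : AntitoneOn v (Set.Icc 0 R) := by
    apply antitoneOn_of_deriv_nonpos (convex_Icc 0 R)
    · exact fun r hr => (hv r hr).continuousAt.continuousWithinAt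
    · rw [interior_Icc]
      exact fun r hr => (hv r (Set.Ioo_subset_Icc_self hr)).differentiableAt.differentiableWithinAt
    · rw [interior_Icc]
      intro r hr
      rw [(hv r (Set.Ioo_subset_Icc_self hr)).deriv]
      exact (hdec r hr).le
  obtain ⟨x, hx, hxe⟩ := exists_hasDerivAt_eq_slope v v' hR
    (fun r hr => (hv r hr).continuousAt.continuousWithinAt)
    (fun r hr => hv r (Set.Ioo_subset_Icc_self hr))
  have hxI := Set.Ioo_subset_Icc_self hx
  have h0I : (0:ℝ) ∈ Set.Icc 0 R := ⟨le_rfl, hR.le⟩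
  have hRI : R ∈ Set.Icc 0 R := ⟨hR.le, le_rfl⟩
  have hE := hanti h0I hxI hx.1.le
  simp only [hv'0] at hE
  have hm : sInf (FΛ '' Set.Icc 0 (v 0)) ≤ FΛ (v x) := by
    apply csInf_le (isCompact_Icc.image hFc).bddBelow
    refine ⟨v x, ⟨?_, hvanti h0I hxI hx.1.le⟩, rfl⟩
    rw [← hvR]
    exact hvanti hxI hRI hx.2.le
  have e : (v 0) ^ 2 / (2 * Λ * R ^ 2) = v' x ^ 2 / (2 * Λ) := by
    rw [hxe, hvR, sub_zero]
    field_simp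
    ring
  rw [e, hFbarΛ]
  have := mul_le_mul_of_nonneg_left hm hlam
  norm_num at hE
  linarith
end

section
/- Let N ≥ 1 be an integer, let R > 0, λ > 0, Λ ≥ 1, and let f : ℝ → ℝ be continuous, with F_Λ(s) = ∫₀ˢ f⁺(t) dt − (1/Λ²) ∫₀ˢ f⁻(t) dt. Let v : [0,R] → ℝ be twice continuously differentiable with v'(0) = 0, v(R) = 0, and v'(r) < 0 for all r ∈ (0,R). Assume that for every r ∈ (0,R): if v''(r) ≤ 0 then −(1/Λ) v''(r) − ((N−1)/(Λ r)) v'(r) = λ f(v(r)), and if v''(r) ≥ 0 then −Λ v''(r) − ((N−1)/(Λ r)) v'(r) = λ f(v(r)). Then F_Λ(v(0)) ≥ 0. -/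
open Filter Topology MeasureTheory

theorem stmt11 (N : ℕ) (hN : 1 ≤ N) (R lam Λ : ℝ) (hR : 0 < R) (hlam : 0 < lam) (hΛ : 1 ≤ Λ)
    (f : ℝ → ℝ) (hf : Continuous f)
    (FΛ : ℝ → ℝ)
    (hFΛ : ∀ s, FΛ s = (∫ t in (0:ℝ)..s, max (f t) 0)
      - (1 / Λ ^ 2) * ∫ t in (0:ℝ)..s, max (-f t) 0)
    (v v' v'' : ℝ → ℝ)
    (hv : ∀ r ∈ Set.Icc (0:ℝ) R, HasDerivAt v (v' r) r)
    (hv' : ∀ r ∈ Set.Icc (0:ℝ) R, HasDerivAt v' (v'' r) r)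
    (hv''cont : ContinuousOn v'' (Set.Icc 0 R))
    (hv'0 : v' 0 = 0)
    (hvR : v R = 0)
    (hdec : ∀ r ∈ Set.Ioo (0:ℝ) R, v' r < 0)
    (hode1 : ∀ r ∈ Set.Ioo (0:ℝ) R, v'' r ≤ 0 →
      -(1 / Λ) * v'' r - (((N:ℝ) - 1) / (Λ * r)) * v' r = lam * f (v r))
    (hode2 : ∀ r ∈ Set.Ioo (0:ℝ) R, 0 ≤ v'' r →
      -Λ * v'' r - (((N:ℝ) - 1) / (Λ * r)) * v' r = lam * f (v r)) :
    FΛ (v 0) ≥ 0 := by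
  have hL : 0 < Λ := by linarith
  have hp : Continuous fun t => max (f t) 0 := by fun_prop
  have hm : Continuous fun t => max (-f t) 0 := by fun_prop
  have hF : ∀ s, HasDerivAt FΛ (max (f s) 0 - (1 / Λ ^ 2) * max (-f s) 0) s := by
    intro s
    have h1 := (hp.integral_hasStrictDerivAt 0 s).hasDerivAt
    have h2 := ((hm.integral_hasStrictDerivAt 0 s).hasDerivAt).const_mul (1 / Λ ^ 2)
    rw [funext hFΛ]
    exact h1.sub h2
  have hE : ∀ r ∈ Set.Icc (0:ℝ) R, HasDerivAt
      (fun r => lam * FΛ (v r) + 1 / (2 * Λ) * (v' r * v' r))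
      (lam * ((max (f (v r)) 0 - (1 / Λ ^ 2) * max (-f (v r)) 0) * v' r)
        + 1 / (2 * Λ) * (v'' r * v' r + v' r * v'' r)) r := by
    intro r hr
    exact (((hF (v r)).comp r (hv r hr)).const_mul lam).add
      (((hv' r hr).mul (hv' r hr)).const_mul (1 / (2 * Λ)))
  have hanti : AntitoneOn (fun r => lam * FΛ (v r) + 1 / (2 * Λ) * (v' r * v' r))
      (Set.Icc 0 R) := by
    apply antitoneOn_of_deriv_nonpos (convex_Icc 0 R)
    · exact fun r hr => (hE r hr).continuousAt.continuousWithinAt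
    · intro r hr
      rw [interior_Icc] at hr
      exact (hE r (Set.Ioo_subset_Icc_self hr)).differentiableAt.differentiableWithinAt
    · intro r hr
      rw [interior_Icc] at hr
      rw [(hE r (Set.Ioo_subset_Icc_self hr)).deriv]
      have hd := hdec r hr
      have hN1 : (0:ℝ) ≤ (N:ℝ) - 1 := by
        have : (1:ℝ) ≤ N := by exact_mod_cast hN
        linarith
      have hD : 0 ≤ -((((N:ℝ) - 1) / (Λ * r)) * v' r) := by
        have : 0 ≤ ((N:ℝ) - 1) / (Λ * r) := div_nonneg hN1 (mul_pos hL hr.1).le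
        nlinarith
      have key : 0 ≤ lam * (max (f (v r)) 0 - (1 / Λ ^ 2) * max (-f (v r)) 0)
          + 1 / Λ * v'' r := by
        have hi : 0 < 1 / Λ := by positivity
        rcases le_total (v'' r) 0 with h | h
        · have e := hode1 r hr h
          have h3 : 0 ≤ lam * f (v r) := by nlinarith
          have h4 : 0 ≤ f (v r) := nonneg_of_mul_nonneg_right h3 hlam
          rw [max_eq_left h4, max_eq_right (by linarith)]
          linarith
        · have e := hode2 r hr h
          rcases le_total 0 (f (v r)) with h4 | h4
          · rw [max_eq_left h4, max_eq_right (by linarith)]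
            have := mul_nonneg hlam.le h4
            have := mul_nonneg hi.le h
            linarith
          · rw [max_eq_right h4, max_eq_left (by linarith)]
            have e2 : lam * (0 - 1 / Λ ^ 2 * -f (v r)) + 1 / Λ * v'' r
                = 1 / Λ ^ 2 * (lam * f (v r) + Λ * v'' r) := by
              field_simp
              ring
            rw [e2]
            apply mul_nonneg (by positivity)
            linarith
      have e3 : lam * ((max (f (v r)) 0 - (1 / Λ ^ 2) * max (-f (v r)) 0) * v' r)
          + 1 / (2 * Λ) * (v'' r * v' r + v' r * v'' r)
          = (lam * (max (f (v r)) 0 - (1 / Λ ^ 2) * max (-f (v r)) 0)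
          + 1 / Λ * v'' r) * v' r := by
        field_simp
        ring
      rw [e3]
      exact mul_nonpos_of_nonneg_of_nonpos key hd.le
  have h := hanti (Set.left_mem_Icc.2 hR.le) (Set.right_mem_Icc.2 hR.le) hR.le
  have hF0 : FΛ 0 = 0 := by simp [hFΛ]
  simp only [hvR, hv'0, hF0] at h
  have h5 : 0 ≤ 1 / (2 * Λ) * (v' R * v' R) :=
    mul_nonneg (by positivity) (mul_self_nonneg _)
  have h6 : 0 ≤ lam * FΛ (v 0) := by linarith
  exact nonneg_of_mul_nonneg_right h6 hlam
end
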